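/- There is an absolute constant k ∈ ℕ such that the following holds. Let G = (S₀, S₁, E) be a finite weighted game with maximal absolute weight W, t = t₁/t₂ ∈ ℚ a threshold, and G' the expanded game. If P₀ has a winning strategy from (s_init, 0) in G' for the mean-payoff objective MP(t), then P₀ has a winning strategy σ' from (s_init, 0) for MP(t) such that every configuration (s, c) visited along any outcome of σ' satisfies c ≤ M', where M' = 2^{k·(t + W·(8 t₁ t₂ (t+1)³ |S|² + 1) + |S| + |E|·W + |S|·(⌈t⌉+1))}. -/

import Mathlib

namespace AvgEnergy

/-- An integer-weighted edge over a state space `α`. -/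
abbrev WEdge (α : Type*) : Type _ := α × ℤ × α

/-- A finite turn-based weighted game `G = (S₀, S₁, E)`:
`S₀` and `S₁` are disjoint sets of states covering `S`, edges carry integer
weights bounded in absolute value by `W`, and every state has an outgoing edge. -/
structure Game (S : Type*) where
  S0 : Set S
  S1 : Set S
  E : Set (WEdge S)
  W : ℕ
  disj : Disjoint S0 S1
  cover : S0 ∪ S1 = Set.univ
  wbound : ∀ e ∈ E, -(W : ℤ) ≤ e.2.1 ∧ e.2.1 ≤ (W : ℤ)
  total : ∀ s : S, ∃ w s', (s, w, s') ∈ E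

variable {α : Type*}

/-- A play from `s`: an infinite sequence of consecutive edges of `E` starting at `s`. -/
def IsPlay (E : Set (WEdge α)) (s : α) (π : ℕ → WEdge α) : Prop :=
  (∀ i, π i ∈ E) ∧ (π 0).1 = s ∧ ∀ i, (π i).2.2 = (π (i + 1)).1

/-- Energy level of the length-`n` prefix of `π`. -/
def EL (π : ℕ → WEdge α) (n : ℕ) : ℤ :=
  ∑ i ∈ Finset.range n, (π i).2.1

/-- Mean-payoff of the length-`n` prefix of `π`. -/
def MP (π : ℕ → WEdge α) (n : ℕ) : ℚ := (EL π n : ℚ) / n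

/-- Average-energy of the length-`n` prefix of `π`. -/
def AE (π : ℕ → WEdge α) (n : ℕ) : ℚ :=
  (∑ i ∈ Finset.range n, (EL π (i + 1) : ℚ)) / n

/-- `limsup_{n → ∞} f n ≤ t` (ε-characterization, valid in `ℚ`). -/
def LimsupLE (f : ℕ → ℚ) (t : ℚ) : Prop :=
  ∀ ε : ℚ, 0 < ε → ∃ N, ∀ n ≥ N, f n ≤ t + ε

/-- The state reached after following the finite prefix `ρ` from `s`. -/
def EndSt (s : α) (ρ : List (WEdge α)) : α :=
  (ρ.getLast?.map (fun e => e.2.2)).getD s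

/-- `ρ` is a finite play prefix from `s` in the graph with edge set `E`. -/
def IsPrefixFrom (E : Set (WEdge α)) (s : α) (ρ : List (WEdge α)) : Prop :=
  (∀ e ∈ ρ, e ∈ E) ∧ List.Chain' (fun e f => e.2.2 = f.1) ρ ∧
    ∀ e, ρ.head? = some e → e.1 = s

/-- A strategy (of the player owning the states in `S0`) from `s`: it assigns to every
play prefix from `s` ending in a state of `S0` a valid outgoing edge. -/
def IsStrategy (E : Set (WEdge α)) (S0 : Set α) (s : α)
    (σ : List (WEdge α) → WEdge α) : Prop :=
  ∀ ρ, IsPrefixFrom E s ρ → EndSt s ρ ∈ S0 → σ ρ ∈ E ∧ (σ ρ).1 = EndSt s ρ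

/-- The length-`n` prefix of a play, as a list of edges. -/
def Pref (π : ℕ → WEdge α) (n : ℕ) : List (WEdge α) :=
  List.ofFn (fun i : Fin n => π i)

/-- `π` is an outcome of the strategy `σ` (for the player owning `S0`) from `s`. -/
def IsOutcome (E : Set (WEdge α)) (S0 : Set α) (s : α)
    (σ : List (WEdge α) → WEdge α) (π : ℕ → WEdge α) : Prop :=
  IsPlay E s π ∧ ∀ n, EndSt s (Pref π n) ∈ S0 → π n = σ (Pref π n)

/-- Configurations of the expanded game: `⊥` is `none`. -/
abbrev Conf (S : Type*) := Option (S × ℕ)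

/-- Edges of the expanded infinite-state weighted game `G'`:
`((s,c), c', (s',c'))` whenever `(s,w,s') ∈ E` and `c' = c + w ≥ 0`;
`((s,c), ⌈t⌉+1, ⊥)` whenever some `(s,w,s') ∈ E` has `c + w < 0`; and
`(⊥, ⌈t⌉+1, ⊥)`. -/
def ExpE {S : Type*} (G : Game S) (t : ℚ) : Set (WEdge (Conf S)) :=
  {e | (∃ (s : S) (c : ℕ) (w : ℤ) (s' : S) (c' : ℕ), (s, w, s') ∈ G.E ∧ (c : ℤ) + w = (c' : ℤ) ∧
          e = (some (s, c), (c' : ℤ), some (s', c'))) ∨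
       (∃ (s : S) (c : ℕ) (w : ℤ) (s' : S), (s, w, s') ∈ G.E ∧ (c : ℤ) + w < 0 ∧
          e = (some (s, c), ⌈t⌉ + 1, (none : Conf S))) ∨
       e = ((none : Conf S), ⌈t⌉ + 1, (none : Conf S))}

/-- The configurations of the expanded game belonging to player `P₀`. -/
def ExpS0 {S : Type*} (G : Game S) : Set (Conf S) :=
  {γ | ∃ s c, s ∈ G.S0 ∧ γ = some (s, c)}

/-- The state (configuration) visited at position `n` along a play from `s`:
`γ₀ = s` and `γ_{n+1}` is the target of the `(n+1)`-st edge. -/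
def StAt (s : α) (π : ℕ → WEdge α) : ℕ → α
  | 0 => s
  | n + 1 => (π n).2.2

end AvgEnergy

namespace AvgEnergy

theorem exists_low_cycle {α : Type*} {Low : Set α} (hLow : Low.Finite) (B : ℕ) (v : ℕ → α)
    (x : ℕ → ℤ) (h0 : x 0 = 0) (hB : ∀ n, x (n + 1) ≤ x n + B)
    (hL : ∀ n, v (n + 1) ∉ Low → x (n + 1) ≤ x n - 1)
    (hx : ∀ D : ℕ, 0 < D → ∃ N : ℕ, ∀ n ≥ N, -(n : ℤ) ≤ D * x n) :
    ∃ i j, i < j ∧ v i = v j ∧ v j ∈ Low ∧ x i ≤ x j := by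
  classical
  by_contra! hno
  obtain ⟨K, hK⟩ : ∃ K : ℕ, ∀ j, v j ∈ Low → x j ≤ K := by
    have h1 : ∀ γ : α, ∃ K : ℕ, ∀ j, v j = γ → v j ∈ Low → x j ≤ K := by
      intro γ
      by_cases hγ : ∃ j, v j = γ
      · refine ⟨(x (Nat.find hγ)).toNat, fun j hj hl => ?_⟩
        rcases (Nat.find_min' hγ hj).eq_or_lt with h | h
        · rw [h]; exact Int.self_le_toNat _
        · exact (hno _ _ h ((Nat.find_spec hγ).trans hj.symm) hl).le.trans (Int.self_le_toNat _)
      · exact ⟨0, fun j hj => absurd ⟨j, hj⟩ hγ⟩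
    choose Kf hKf using h1
    obtain ⟨K, hK⟩ := (hLow.image Kf).bddAbove
    refine ⟨K, fun j hj => (hKf _ j rfl hj).trans ?_⟩
    exact_mod_cast hK ⟨_, hj, rfl⟩
  set N := hLow.toFinset.card with hN
  set D : ℕ := 2 * ((B + 1) * N + 1) with hD
  obtain ⟨N0, hN0⟩ := hx D (by positivity)
  obtain ⟨L, hLb⟩ : ∃ L : ℕ, ∀ n : ℕ, -(n : ℤ) - D * L ≤ D * x n := by
    obtain ⟨b, hb⟩ := ((Set.finite_Iio N0).image x).bddBelow
    refine ⟨b.natAbs, fun n => ?_⟩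
    rcases lt_or_ge n N0 with h | h
    · have h1 : b ≤ x n := hb ⟨n, h, rfl⟩
      have h2 : -(b.natAbs : ℤ) ≤ b := by omega
      have h3 : (D : ℤ) * (-(b.natAbs : ℤ)) ≤ D * x n :=
        mul_le_mul_of_nonneg_left (h2.trans h1) (by positivity)
      push_cast at *
      linarith
    · have := hN0 n h
      have : (0 : ℤ) ≤ D * (b.natAbs : ℤ) := by positivity
      linarith [hN0 n h]
  have hcount : ∀ n, x n ≤ (B + 1) * (((Finset.range n).filter fun i => v (i + 1) ∈ Low).card : ℤ)
      - n := by
    intro n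
    induction n with
    | zero => simp [h0]
    | succ n ih =>
      rw [Finset.range_add_one, Finset.filter_insert]
      split_ifs with h
      · rw [Finset.card_insert_of_notMem (by simp)]
        push_cast
        linarith [hB n]
      · push_cast
        linarith [hL n h]
  set q : ℕ := (B + 1) * N * (L + K + 1) + L + 1 with hq
  have hcard : ((Finset.range (D * q)).filter fun i => v (i + 1) ∈ Low).card
      ≤ N * (q + L + K + 1) := by
    have hI : (Finset.Icc (-(q : ℤ) - L) K).card = q + L + K + 1 := by
      rw [Int.card_Icc]; omega
    rw [hN, ← hI, ← Finset.card_product]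
    refine Finset.card_le_card_of_injOn (fun i => (v (i + 1), x (i + 1))) ?_ ?_
    · intro i hi
      simp only [Finset.coe_filter, Finset.mem_range, Set.mem_ofPred_eq] at hi
      simp only [Finset.coe_product, Set.mem_prod, Finset.mem_coe, Set.Finite.mem_toFinset,
        Finset.mem_Icc]
      refine ⟨hi.2, ?_, hK _ hi.2⟩
      have h1 := hLb (i + 1)
      have h2 : ((i + 1 : ℕ) : ℤ) ≤ D * q := by exact_mod_cast hi.1
      have hDp : (0 : ℤ) < D := by positivity
      refine le_of_mul_le_mul_left ?_ hDp
      linarith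
    · intro i hi j hj hij
      simp only [Finset.coe_filter, Finset.mem_range, Set.mem_ofPred_eq] at hi hj
      simp only [Prod.mk.injEq] at hij
      rcases lt_trichotomy i j with h | h | h
      · have := hno _ _ (Nat.succ_lt_succ h) hij.1 hj.2
        exact absurd hij.2 this.ne'
      · exact h
      · have := hno _ _ (Nat.succ_lt_succ h) hij.1.symm hi.2
        exact absurd hij.2 this.ne
  have h1 := hcount (D * q)
  have h2 := hLb (D * q)
  have hDp : (0 : ℤ) < D := by positivity
  have h3 : -(q : ℤ) - L ≤ x (D * q) := by
    refine le_of_mul_le_mul_left ?_ hDp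
    push_cast at h2
    linarith
  have h4 : ((B : ℤ) + 1) * (((Finset.range (D * q)).filter fun i => v (i + 1) ∈ Low).card : ℤ)
      ≤ (B + 1) * (N * (q + L + K + 1)) :=
    mul_le_mul_of_nonneg_left (by exact_mod_cast hcard) (by positivity)
  have h5 : (D : ℤ) * q = 2 * (((B + 1) * N + 1) * q) := by rw [hD]; push_cast; ring
  have h6 : (q : ℤ) = (B + 1) * N * (L + K + 1) + L + 1 := by rw [hq]; push_cast; ring
  push_cast at h1
  have h7 : (0 : ℤ) ≤ (B + 1) * N * q := by positivity
  nlinarith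

theorem EndSt_append {α : Type*} (s : α) (ρ : List (WEdge α)) (e : WEdge α) :
    EndSt s (ρ ++ [e]) = e.2.2 := by
  simp [EndSt]

theorem Pref_succ {α : Type*} (π : ℕ → WEdge α) (n : ℕ) : Pref π (n + 1) = Pref π n ++ [π n] := by
  rw [Pref, List.ofFn_succ']
  simp [Pref]

theorem EndSt_Pref {α : Type*} (s : α) (π : ℕ → WEdge α) (n : ℕ) :
    EndSt s (Pref π n) = StAt s π n := by
  cases n with
  | zero => simp [Pref, EndSt, StAt]
  | succ n => rw [Pref_succ, EndSt_append, StAt]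

theorem IsPlay.src {α : Type*} {E : Set (WEdge α)} {s : α} {π : ℕ → WEdge α} (h : IsPlay E s π)
    (n : ℕ) : (π n).1 = StAt s π n := by
  cases n with
  | zero => exact h.2.1
  | succ n => exact (h.2.2 n).symm

theorem IsPrefixFrom.append {α : Type*} {E : Set (WEdge α)} {s : α} {ρ : List (WEdge α)}
    {e : WEdge α} (h : IsPrefixFrom E s ρ) (he : e ∈ E) (hs : e.1 = EndSt s ρ) :
    IsPrefixFrom E s (ρ ++ [e]) := by
  refine ⟨fun f hf => ?_, List.isChain_append.2 ⟨h.2.1, List.isChain_singleton _, ?_⟩, ?_⟩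
  · rcases List.mem_append.1 hf with hf | hf
    · exact h.1 f hf
    · rwa [List.mem_singleton.1 hf]
  · rintro f hf g hg
    obtain rfl : e = g := by simpa using hg
    rw [hs, EndSt, Option.mem_def.1 hf]
    rfl
  · intro f hf
    cases ρ with
    | nil =>
      obtain rfl : e = f := by simpa using hf
      simpa [EndSt] using hs
    | cons a l => exact h.2.2 f (by simpa using hf)

/-- The total credit gained along a history. -/
def credit {α : Type*} (g : WEdge α → ℤ) (ρ : List (WEdge α)) : ℤ := (ρ.map g).sum

theorem credit_append {α : Type*} (g : WEdge α → ℤ) (ρ : List (WEdge α)) (e : WEdge α) :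
    credit g (ρ ++ [e]) = credit g ρ + g e := by
  simp [credit]

/-- The edge `e` extends the history `ρ` consistently with `σ`, without closing a cycle of
nonnegative credit on a vertex of `Low`. -/
structure OpenStep {α : Type*} (E : Set (WEdge α)) (S0 : Set α) (s : α)
    (σ : List (WEdge α) → WEdge α) (g : WEdge α → ℤ) (Low : Set α) (ρ : List (WEdge α))
    (e : WEdge α) : Prop where
  mem : e ∈ E
  src : e.1 = EndSt s ρ
  follows : EndSt s ρ ∈ S0 → e = σ ρ
  lt : ∀ τ, τ <+: ρ → EndSt s τ = e.2.2 → e.2.2 ∈ Low → credit g (ρ ++ [e]) < credit g τ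

/-- Histories consistent with `σ` that contain no cycle of nonnegative credit on a vertex of
`Low`. -/
def OpenHist {α : Type*} (E : Set (WEdge α)) (S0 : Set α) (s : α)
    (σ : List (WEdge α) → WEdge α) (g : WEdge α → ℤ) (Low : Set α) (ρ : List (WEdge α)) : Prop :=
  ∀ ρ' e, ρ' ++ [e] <+: ρ → OpenStep E S0 s σ g Low ρ' e

section OpenHist

variable {α : Type*} {E : Set (WEdge α)} {S0 : Set α} {s : α}
  {σ : List (WEdge α) → WEdge α} {g : WEdge α → ℤ} {Low : Set α}

theorem openHist_nil : OpenHist E S0 s σ g Low [] := fun ρ' e h => by simp at h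

theorem OpenHist.of_prefix {ρ ρ' : List (WEdge α)} (h : OpenHist E S0 s σ g Low ρ)
    (hp : ρ' <+: ρ) : OpenHist E S0 s σ g Low ρ' :=
  fun _ _ h' => h _ _ (h'.trans hp)

theorem OpenHist.append {ρ : List (WEdge α)} {e : WEdge α} (h : OpenHist E S0 s σ g Low ρ)
    (he : OpenStep E S0 s σ g Low ρ e) : OpenHist E S0 s σ g Low (ρ ++ [e]) := by
  intro ρ' e' hp
  rcases List.prefix_concat_iff.1 hp with hp | hp
  · obtain ⟨rfl, h2⟩ := List.append_inj' hp rfl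
    obtain rfl : e' = e := by simpa using h2
    exact he
  · exact h _ _ hp

theorem OpenHist.isPrefixFrom {ρ : List (WEdge α)} (h : OpenHist E S0 s σ g Low ρ) :
    IsPrefixFrom E s ρ := by
  induction ρ using List.reverseRecOn with
  | nil => exact ⟨by simp, List.isChain_nil, by simp⟩
  | append_singleton l e ih =>
    have hs := h l e (List.prefix_refl _)
    exact (ih (h.of_prefix (List.prefix_append _ _))).append hs.mem hs.src

theorem credit_Pref (π : ℕ → WEdge α) (n : ℕ) :
    credit g (Pref π n) = ∑ i ∈ Finset.range n, g (π i) := by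
  induction n with
  | zero => simp [Pref, credit]
  | succ n ih => rw [Pref_succ, credit_append, ih, Finset.sum_range_succ]

theorem Pref_prefix (π : ℕ → WEdge α) {m n : ℕ} (h : m ≤ n) : Pref π m <+: Pref π n := by
  induction h with
  | refl => exact List.prefix_refl _
  | step _ ih => rw [Pref_succ]; exact ih.trans (List.prefix_append _ _)

theorem exists_not_openHist_Pref (hLow : Low.Finite) (B : ℕ) (hB : ∀ e ∈ E, g e ≤ B)
    (hL : ∀ e ∈ E, e.2.2 ∉ Low → g e ≤ -1)
    (hwin : ∀ π, IsOutcome E S0 s σ π → ∀ D : ℕ, 0 < D → ∃ N : ℕ, ∀ n ≥ N,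
      -(n : ℤ) ≤ D * ∑ i ∈ Finset.range n, g (π i)) (π : ℕ → WEdge α) :
    ∃ n, ¬ OpenHist E S0 s σ g Low (Pref π n) := by
  by_contra! hopen
  have hstep : ∀ n, OpenStep E S0 s σ g Low (Pref π n) (π n) := fun n =>
    hopen (n + 1) _ _ (by rw [Pref_succ])
  have hout : IsOutcome E S0 s σ π := by
    refine ⟨⟨fun i => (hstep i).mem, (hstep 0).src, fun i => ?_⟩, fun n => (hstep n).follows⟩
    rw [(hstep (i + 1)).src, Pref_succ, EndSt_append]
  obtain ⟨i, j, hij, hv, hl, hx⟩ := exists_low_cycle hLow B (fun n => EndSt s (Pref π n))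
    (fun n => credit g (Pref π n)) (by simp [Pref, credit])
    (fun n => by
      simp only [Pref_succ, credit_append]
      linarith [hB _ (hstep n).mem])
    (fun n h => by
      simp only [Pref_succ, credit_append, EndSt_append] at h ⊢
      linarith [hL _ (hstep n).mem h])
    (fun D hD => by simpa only [credit_Pref] using hwin π hout D hD)
  obtain ⟨k, rfl⟩ : ∃ k, j = k + 1 := ⟨j - 1, by omega⟩
  simp only [Pref_succ, EndSt_append] at hv hl hx
  exact ((hstep k).lt _ (Pref_prefix π (by omega)) hv hl).not_ge hx

theorem exists_credit_bound (hfin : ∀ γ, {e ∈ E | e.1 = γ}.Finite)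
    (hπ : ∀ π : ℕ → WEdge α, ∃ n, ¬ OpenHist E S0 s σ g Low (Pref π n)) :
    ∃ m : ℕ, ∀ ρ, OpenHist E S0 s σ g Low ρ → -(m : ℤ) ≤ credit g ρ := by
  by_contra! hno
  set Bad : List (WEdge α) → Prop := fun ρ => ∀ m : ℕ, ∃ ρ', OpenHist E S0 s σ g Low ρ' ∧
    ρ <+: ρ' ∧ credit g ρ' < -m with hBad
  have hext : ∀ ρ, Bad ρ → ∃ e, Bad (ρ ++ [e]) := by
    intro ρ hρ
    by_contra! hne
    simp only [hBad, not_forall, not_exists, not_and, not_lt] at hne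
    choose m hm using hne
    obtain ⟨b, hb⟩ := ((hfin (EndSt s ρ)).image m).bddAbove
    obtain ⟨ρ', h1, ⟨l, rfl⟩, h3⟩ := hρ (b + (credit g ρ).natAbs)
    cases l with
    | nil => rw [List.append_nil] at h3; omega
    | cons e l =>
      have hp : ρ ++ [e] <+: ρ ++ e :: l := ⟨l, by simp⟩
      have hs := h1 _ _ hp
      have h4 := hm e _ h1 hp
      have h5 : m e ≤ b := hb ⟨e, ⟨hs.mem, hs.src⟩, rfl⟩
      omega
  choose f hf using hext
  let F : ℕ → {ρ // Bad ρ} := fun n => Nat.rec ⟨[], fun m => by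
    obtain ⟨ρ, h1, h2⟩ := hno m
    exact ⟨ρ, h1, List.nil_prefix, h2⟩⟩ (fun _ ρ => ⟨ρ.1 ++ [f ρ.1 ρ.2], hf ρ.1 ρ.2⟩) n
  have hF : ∀ n, Pref (fun n => f (F n).1 (F n).2) n = (F n).1 := by
    intro n
    induction n with
    | zero => simp [Pref, F]
    | succ n ih => rw [Pref_succ, ih]
  obtain ⟨n, hn⟩ := hπ fun n => f (F n).1 (F n).2
  rw [hF] at hn
  obtain ⟨ρ', h1, h2, -⟩ := (F n).2 0
  exact hn (h1.of_prefix h2)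

/-- A winning strategy yields a set of vertices in which bounded credit suffices forever. -/
theorem exists_potential (hfin : ∀ γ, {e ∈ E | e.1 = γ}.Finite) (hLow : Low.Finite) (B : ℕ)
    (hB : ∀ e ∈ E, g e ≤ B) (hL : ∀ e ∈ E, e.2.2 ∉ Low → g e ≤ -1) (hσ : IsStrategy E S0 s σ)
    (hwin : ∀ π, IsOutcome E S0 s σ π → ∀ D : ℕ, 0 < D → ∃ N : ℕ, ∀ n ≥ N,
      -(n : ℤ) ≤ D * ∑ i ∈ Finset.range n, g (π i)) :
    ∃ (A : Set α) (p : α → ℕ), s ∈ A ∧ ∀ γ ∈ A,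
      (γ ∈ S0 → ∃ e ∈ E, e.1 = γ ∧ e.2.2 ∈ A ∧ (p e.2.2 : ℤ) ≤ p γ + g e) ∧
      (γ ∉ S0 → ∀ e ∈ E, e.1 = γ → e.2.2 ∈ A ∧ (p e.2.2 : ℤ) ≤ p γ + g e) := by
  obtain ⟨m, hm⟩ := exists_credit_bound hfin (exists_not_openHist_Pref hLow B hB hL hwin)
  set P : α → Set ℕ := fun γ => {n | ∃ ρ, OpenHist E S0 s σ g Low ρ ∧ EndSt s ρ = γ ∧
    (n : ℤ) = m + credit g ρ} with hP
  have hA : ∀ ρ, OpenHist E S0 s σ g Low ρ → (P (EndSt s ρ)).Nonempty ∧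
      ((sInf (P (EndSt s ρ)) : ℕ) : ℤ) ≤ m + credit g ρ := by
    intro ρ hρ
    have h1 := hm ρ hρ
    have h2 : (m + credit g ρ).toNat ∈ P (EndSt s ρ) := ⟨ρ, hρ, rfl, by omega⟩
    refine ⟨⟨_, h2⟩, ?_⟩
    have := Nat.sInf_le h2
    omega
  have hchild : ∀ ρ, OpenHist E S0 s σ g Low ρ → ∀ e ∈ E, e.1 = EndSt s ρ →
      (EndSt s ρ ∈ S0 → e = σ ρ) →
      (P e.2.2).Nonempty ∧ ((sInf (P e.2.2) : ℕ) : ℤ) ≤ m + credit g ρ + g e := by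
    intro ρ hρ e he hs hf
    by_cases hst : OpenStep E S0 s σ g Low ρ e
    · have := hA _ (hρ.append hst)
      rwa [EndSt_append, credit_append, ← add_assoc] at this
    · have : ∃ ρ', ρ' <+: ρ ∧ EndSt s ρ' = e.2.2 ∧ credit g ρ' ≤ credit g (ρ ++ [e]) := by
        by_contra! h
        exact hst ⟨he, hs, hf, fun ρ' h1 h2 _ => h ρ' h1 h2⟩
      obtain ⟨ρ', h1, h2, h3⟩ := this
      have h4 := hA _ (hρ.of_prefix h1)
      rw [h2] at h4
      rw [credit_append] at h3
      exact ⟨h4.1, by linarith [h4.2]⟩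
  refine ⟨{γ | (P γ).Nonempty}, fun γ => sInf (P γ), ?_, fun γ hγ => ?_⟩
  · exact (hA [] openHist_nil).1
  · obtain ⟨ρ, hρ, rfl, hn⟩ := Nat.sInf_mem hγ
    refine ⟨fun h0 => ?_, fun h0 e he hs => ?_⟩
    · have h := hσ ρ hρ.isPrefixFrom h0
      refine ⟨σ ρ, h.1, h.2, ?_⟩
      simp only [hn]
      exact hchild ρ hρ _ h.1 h.2 fun _ => rfl
    · simp only [hn]
      exact hchild ρ hρ e he hs fun h => absurd h h0

end OpenHist

/-- `P₀` can force a visit to `T` while all configurations visited strictly before have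
counter values in `[lo, hi)`. -/
inductive Reach {S : Type*} (G : Game S) (lo hi : ℤ) (T : S → ℤ → Prop) : S → ℤ → Prop
  | base {s c} : T s c → Reach G lo hi T s c
  | choose {s c w s'} : s ∈ G.S0 → lo ≤ c → c < hi → (s, w, s') ∈ G.E →
      Reach G lo hi T s' (c + w) → Reach G lo hi T s c
  | forced {s c} : s ∉ G.S0 → lo ≤ c → c < hi →
      (∀ w s', (s, w, s') ∈ G.E → Reach G lo hi T s' (c + w)) → Reach G lo hi T s c

namespace Reach

variable {S : Type*} {G : Game S} {lo hi : ℤ} {T : S → ℤ → Prop}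

theorem bind {lo' hi' : ℤ} {T' : S → ℤ → Prop} (hlo : lo' ≤ lo) (hhi : hi ≤ hi')
    (hT : ∀ s c, T s c → Reach G lo' hi' T' s c) {s : S} {c : ℤ} (h : Reach G lo hi T s c) :
    Reach G lo' hi' T' s c := by
  induction h with
  | base h => exact hT _ _ h
  | choose h0 h1 h2 he _ ih => exact .choose h0 (hlo.trans h1) (h2.trans_le hhi) he ih
  | forced h0 h1 h2 _ ih => exact .forced h0 (hlo.trans h1) (h2.trans_le hhi) ih

theorem mono_hi {hi' : ℤ} (hhi : hi ≤ hi') {s : S} {c : ℤ} (h : Reach G lo hi T s c) :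
    Reach G lo hi' T s c :=
  h.bind le_rfl hhi fun _ _ => .base

theorem shift (d : ℤ) {s : S} {c : ℤ} (h : Reach G lo hi T s c) :
    Reach G (lo + d) (hi + d) (fun s c => T s (c - d)) s (c + d) := by
  induction h with
  | base h => exact .base (by simpa using h)
  | choose h0 h1 h2 he _ ih =>
    exact .choose h0 (by linarith) (by linarith) he (by rwa [add_right_comm])
  | forced h0 h1 h2 _ ih =>
    exact .forced h0 (by linarith) (by linarith)
      fun w s' he => by rw [add_right_comm]; exact ih w s' he

/-- Only the part of the target within distance `W` below `lo` matters. -/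
theorem restrict {s : S} {c : ℤ} (h : Reach G lo hi T s c) (hc : lo - G.W ≤ c) :
    Reach G lo hi (fun s c => T s c ∧ lo - G.W ≤ c) s c := by
  induction h with
  | base h => exact .base ⟨h, hc⟩
  | choose h0 h1 h2 he _ ih =>
    have := (G.wbound _ he).1
    exact .choose h0 h1 h2 he (ih (by simp only at this; linarith))
  | forced h0 h1 h2 _ ih =>
    refine .forced h0 h1 h2 fun w s' he => ih w s' he ?_
    have := (G.wbound _ he).1
    simp only at this; linarith

end Reach

/-- Winning excursions above level `0` of height at most `h'` can be kept below height `h`. -/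
def HeightStable {S : Type*} (G : Game S) (h h' : ℤ) : Prop :=
  ∀ T : S → ℤ → Prop, (∀ s c, T s c → c < 0) → ∀ (s : S) (c : ℤ), 0 ≤ c → c < G.W →
    Reach G 0 h' T s c → Reach G 0 h T s c

theorem HeightStable.reach_of_reach {S : Type*} {G : Game S} {h h' : ℤ} (hst : HeightStable G h h')
    (hh : 0 ≤ h) {lo l : ℤ} (hlo : lo ≤ l + 1) {T : S → ℤ → Prop} (hT : ∀ s c, T s c → c ≤ l)
    {s : S} {c : ℤ} (hr : Reach G lo (l + 1 + h') T s c) (hc : c ≤ l + G.W) :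
    Reach G lo (l + 1 + h) T s c := by
  set X : S → ℤ → Prop := Reach G lo (l + 1 + h) T with hX
  have lower : ∀ s c, l < c → c ≤ l + G.W →
      Reach G (l + 1) (l + 1 + h') (fun s c => c ≤ l ∧ X s c) s c → X s c := by
    intro s c h1 h2 h3
    have h4 := h3.shift (-(l + 1))
    rw [show l + 1 + -(l + 1) = 0 by ring, show l + 1 + h' + -(l + 1) = h' by ring] at h4
    have h5 := (hst _ (fun s c hs => by linarith [hs.1]) s _ (by linarith) (by linarith)
      h4).shift (l + 1)
    rw [show c + -(l + 1) + (l + 1) = c by ring] at h5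
    refine h5.bind (by linarith) (by linarith) fun s c hs => ?_
    have := hs.2
    rwa [show c - (l + 1) - -(l + 1) = c by ring] at this
  have main : (c ≤ l → X s c) ∧
      (l < c → Reach G (l + 1) (l + 1 + h') (fun s c => c ≤ l ∧ X s c) s c) := by
    clear hc
    induction hr with
    | base ht => exact ⟨fun _ => .base ht, fun hc => absurd (hT _ _ ht) hc.not_ge⟩
    | @choose s c w s' h0 h1 h2 he _ ih =>
      have hw := (G.wbound _ he).2
      simp only at hw
      refine ⟨fun hc => .choose h0 h1 (by linarith) he ?_,
        fun hc => .choose h0 (by linarith) h2 he ?_⟩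
      · rcases le_or_gt (c + w) l with h | h
        · exact ih.1 h
        · exact lower _ _ h (by linarith) (ih.2 h)
      · rcases le_or_gt (c + w) l with h | h
        · exact .base ⟨h, ih.1 h⟩
        · exact ih.2 h
    | @forced s c h0 h1 h2 _ ih =>
      refine ⟨fun hc => .forced h0 h1 (by linarith) fun w s' he => ?_,
        fun hc => .forced h0 (by linarith) h2 fun w s' he => ?_⟩
      · have hw := (G.wbound _ he).2
        simp only at hw
        rcases le_or_gt (c + w) l with h | h
        · exact (ih w s' he).1 h
        · exact lower _ _ h (by linarith) ((ih w s' he).2 h)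
      · rcases le_or_gt (c + w) l with h | h
        · exact .base ⟨h, (ih w s' he).1 h⟩
        · exact (ih w s' he).2 h
  rcases le_or_gt c l with h | h
  · exact main.1 h
  · exact lower _ _ h hc (main.2 h)

/-- The excursions of height `h` that `P₀` can win, together with their return targets. -/
def excursions {S : Type*} (G : Game S) (h : ℕ) : Set (Set (S × Fin G.W) × (S × Fin G.W)) :=
  {q | Reach G 0 h (fun s c => ∃ i : Fin G.W, c = -1 - (i : ℤ) ∧ (s, i) ∈ q.1) q.2.1 (q.2.2 : ℕ)}

theorem excursions_mono {S : Type*} (G : Game S) : Monotone (excursions G) :=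
  fun _ _ h _ hq => Reach.mono_hi (by exact_mod_cast h) hq

theorem heightStable_of_excursions_subset {S : Type*} {G : Game S} {h h' : ℕ}
    (hs : excursions G h' ⊆ excursions G h) : HeightStable G h h' := by
  intro T hT s c h0 hW hr
  lift c to ℕ using h0
  have h1 := hr.restrict (by linarith)
  have h2 : ((({p : S × Fin G.W | T p.1 (-1 - (p.2 : ℤ))}), (s, ⟨c, by omega⟩)) :
      Set (S × Fin G.W) × (S × Fin G.W)) ∈ excursions G h' := by
    refine h1.bind le_rfl le_rfl fun s c ht => .base ?_
    have := hT s c ht.1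
    have h3 := ht.2
    refine ⟨⟨(-1 - c).toNat, by omega⟩, ?_, ?_⟩
    · simp only; omega
    · show T s (-1 - ((-1 - c).toNat : ℤ))
      rw [show -1 - ((-1 - c).toNat : ℤ) = c by omega]
      exact ht.1
  refine (hs h2).bind le_rfl le_rfl ?_
  rintro s c ⟨i, rfl, hi⟩
  exact .base hi

theorem heightStable {S : Type*} [Fintype S] (G : Game S) {n : ℕ} (h' : ℕ)
    (hn : 2 ^ (Fintype.card S * G.W) * (Fintype.card S * G.W) ≤ n) :
    HeightStable G n h' := by
  classical
  have hfin : ∀ h, (excursions G h).Finite := fun h => Set.toFinite _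
  have hcard : Nat.card (Set (S × Fin G.W) × (S × Fin G.W)) =
      2 ^ (Fintype.card S * G.W) * (Fintype.card S * G.W) := by
    simp [Nat.card_eq_fintype_card]
  set b := 2 ^ (Fintype.card S * G.W) * (Fintype.card S * G.W) with hb
  have hmono : Monotone fun h => (excursions G h).ncard :=
    fun _ _ h => Set.ncard_le_ncard (excursions_mono G h) (hfin _)
  have hstab : ∀ m, (excursions G m).ncard = (excursions G (m + 1)).ncard →
      (excursions G (m + 1)).ncard = (excursions G (m + 2)).ncard := by
    intro m hm
    have heq := Set.eq_of_subset_of_ncard_le (excursions_mono G (Nat.le_succ m)) hm.ge (hfin _)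
    have hst := heightStable_of_excursions_subset heq.ge
    congr 1
    refine (excursions_mono G (Nat.le_succ _)).antisymm fun q hq => ?_
    have h3 := hst.reach_of_reach (Int.natCast_nonneg m) (lo := 0) (l := 0) (by norm_num)
      (T := fun s c => ∃ i : Fin G.W, c = -1 - (i : ℤ) ∧ (s, i) ∈ q.1)
      (by rintro s c ⟨i, rfl, -⟩; omega) (s := q.2.1) (c := (q.2.2 : ℕ))
      (Reach.mono_hi (by push_cast; linarith) hq) (by have := q.2.2.2; omega)
    exact Reach.mono_hi (by push_cast; linarith) h3
  have key : ∀ k, b ≤ k → (excursions G k).ncard = (excursions G b).ncard := fun k hk =>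
    Nat.stabilises_of_monotone hmono
      (fun m => by
        rw [← hcard]
        exact Set.ncard_le_card _)
      hstab hk
  refine heightStable_of_excursions_subset ?_
  rcases le_total h' n with h | h
  · exact excursions_mono G h
  · exact (Set.eq_of_subset_of_ncard_le (excursions_mono G h)
      ((key _ (hn.trans h)).trans (key _ hn).symm).le (hfin _)).ge

/-- From `(s, c)`, `P₀` can make sure that the next configuration is different from `⊥` and
satisfies `Q`. -/
def ForceStep {S : Type*} (G : Game S) (s : S) (c : ℕ) (Q : S → ℕ → Prop) : Prop :=
  (s ∈ G.S0 → ∃ (w : ℤ) (s' : S) (c' : ℕ), (s, w, s') ∈ G.E ∧ (c : ℤ) + w = c' ∧ Q s' c') ∧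
  (s ∉ G.S0 → ∀ (w : ℤ) (s' : S), (s, w, s') ∈ G.E → ∃ c' : ℕ, (c : ℤ) + w = c' ∧ Q s' c')

theorem ForceStep.mono {S : Type*} {G : Game S} {s : S} {c : ℕ} {Q Q' : S → ℕ → Prop}
    (h : ForceStep G s c Q) (hQ : ∀ s' c', c' ≤ c + G.W → Q s' c' → Q' s' c') :
    ForceStep G s c Q' := by
  refine ⟨fun h0 => ?_, fun h0 w s' he => ?_⟩
  · obtain ⟨w, s', c', he, hc, hq⟩ := h.1 h0
    have := (G.wbound _ he).2
    exact ⟨w, s', c', he, hc, hQ _ _ (by simp only at this; omega) hq⟩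
  · obtain ⟨c', hc, hq⟩ := h.2 h0 w s' he
    have := (G.wbound _ he).2
    exact ⟨c', hc, hQ _ _ (by simp only at this; omega) hq⟩

theorem ForceStep.reach {S : Type*} {G : Game S} {s : S} {c : ℕ} {lo hi : ℤ}
    {T : S → ℤ → Prop} (h : ForceStep G s c fun s' c' => Reach G lo hi T s' c') (hlo : lo ≤ c)
    (hhi : c < hi) : Reach G lo hi T s c := by
  by_cases h0 : s ∈ G.S0
  · obtain ⟨w, s', c', he, hc, hq⟩ := h.1 h0
    exact .choose h0 hlo hhi he (by rwa [hc])
  · refine .forced h0 hlo hhi fun w s' he => ?_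
    obtain ⟨c', hc, hq⟩ := h.2 h0 w s' he
    rwa [hc]

/-- `p` gives for each configuration of `A` a credit with which `P₀` can stay in `A` forever
without running out of credit, where entering counter value `c'` changes the credit by
`t₁ - t₂ * c'`. -/
def ClosedPotential {S : Type*} (G : Game S) (t₁ t₂ : ℕ) (A : Set (S × ℕ)) (p : S × ℕ → ℕ) :
    Prop :=
  ∀ s c, (s, c) ∈ A →
    ForceStep G s c fun s' c' => (s', c') ∈ A ∧ p (s', c') + t₂ * c' ≤ p (s, c) + t₁

/-- The configurations from which some finite credit suffices with counters bounded by `M`. -/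
def boundedWin {S : Type*} (G : Game S) (t₁ t₂ M : ℕ) : Set (S × ℕ) :=
  {γ | ∃ A p, ClosedPotential G t₁ t₂ A p ∧ (∀ x ∈ A, x.2 ≤ M) ∧ γ ∈ A}

/-- The least credit sufficing with counters bounded by `M`. -/
noncomputable def minCredit {S : Type*} (G : Game S) (t₁ t₂ M : ℕ) (γ : S × ℕ) : ℕ :=
  sInf {n | ∃ A p, ClosedPotential G t₁ t₂ A p ∧ (∀ x ∈ A, x.2 ≤ M) ∧ γ ∈ A ∧ p γ = n}

section BoundedWin

variable {S : Type*} {G : Game S} {t₁ t₂ M : ℕ}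

theorem le_of_mem_boundedWin {γ : S × ℕ} (h : γ ∈ boundedWin G t₁ t₂ M) : γ.2 ≤ M := by
  obtain ⟨A, p, -, h1, h2⟩ := h
  exact h1 _ h2

theorem closedPotential_boundedWin :
    ClosedPotential G t₁ t₂ (boundedWin G t₁ t₂ M) (minCredit G t₁ t₂ M) := by
  rintro s c ⟨A₀, p₀, h₀, hb₀, hm₀⟩
  obtain ⟨A, p, h, hb, hm, hp⟩ :
      minCredit G t₁ t₂ M (s, c) ∈ {n | ∃ A p, ClosedPotential G t₁ t₂ A p ∧
        (∀ x ∈ A, x.2 ≤ M) ∧ (s, c) ∈ A ∧ p (s, c) = n} :=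
    Nat.sInf_mem ⟨_, A₀, p₀, h₀, hb₀, hm₀, rfl⟩
  refine (h s c hm).mono fun s' c' _ hq => ⟨⟨A, p, h, hb, hq.1⟩, ?_⟩
  rw [← hp]
  refine le_trans (Nat.add_le_add_right (Nat.sInf_le ?_) _) hq.2
  exact ⟨A, p, h, hb, hq.1, rfl⟩

theorem subset_boundedWin [Finite S] {D : Set (S × ℕ)} {p : S × ℕ → ℕ} (hD : ∀ x ∈ D, x.2 ≤ M)
    (h : ∀ s c, (s, c) ∈ D → ForceStep G s c fun s' c' => (s', c') ∈ boundedWin G t₁ t₂ M ∨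
      ((s', c') ∈ D ∧ p (s', c') + t₂ * c' ≤ p (s, c) + t₁)) :
    D ⊆ boundedWin G t₁ t₂ M := by
  classical
  have hfin : (boundedWin G t₁ t₂ M).Finite :=
    (Set.finite_univ.prod (Set.finite_Iic M)).subset fun x hx =>
      ⟨Set.mem_univ _, le_of_mem_boundedWin hx⟩
  obtain ⟨K, hK⟩ := (hfin.image (minCredit G t₁ t₂ M)).bddAbove
  intro γ hγ
  refine ⟨boundedWin G t₁ t₂ M ∪ D, fun x => if x ∈ boundedWin G t₁ t₂ M then
    minCredit G t₁ t₂ M x else p x + K + t₂ * M, ?_, ?_, Or.inr hγ⟩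
  · intro s c hsc
    by_cases hw : (s, c) ∈ boundedWin G t₁ t₂ M
    · refine (closedPotential_boundedWin s c hw).mono fun s' c' _ hq => ⟨Or.inl hq.1, ?_⟩
      simp only [hw, hq.1, if_true]
      exact hq.2
    · refine (h s c (hsc.resolve_left hw)).mono fun s' c' _ hq => ?_
      by_cases hw' : (s', c') ∈ boundedWin G t₁ t₂ M
      · refine ⟨Or.inl hw', ?_⟩
        simp only [hw, hw', if_true, if_false]
        have h1 : minCredit G t₁ t₂ M (s', c') ≤ K := hK ⟨_, hw', rfl⟩
        have h2 := Nat.mul_le_mul_left t₂ (le_of_mem_boundedWin hw')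
        simp only at h2
        omega
      · obtain ⟨h1, h2⟩ := hq.resolve_left hw'
        refine ⟨Or.inr h1, ?_⟩
        simp only [hw, hw', if_false]
        omega
  · rintro x (hx | hx)
    · exact le_of_mem_boundedWin hx
    · exact hD x hx

theorem mem_boundedWin_of_forceStep [Finite S] {s : S} {c : ℕ} (hc : c ≤ M)
    (h : ForceStep G s c fun s' c' => (s', c') ∈ boundedWin G t₁ t₂ M) :
    (s, c) ∈ boundedWin G t₁ t₂ M := by
  refine subset_boundedWin (D := {(s, c)}) (p := fun _ => 0) (by simpa using hc) ?_ rfl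
  intro s' c' hs
  obtain ⟨rfl, rfl⟩ := Prod.mk.inj (Set.mem_singleton_iff.1 hs)
  exact h.mono fun _ _ _ => Or.inl

theorem mem_boundedWin_of_reach [Finite S] {T : S → ℤ → Prop}
    (hT : ∀ s c, T s c → ∃ n : ℕ, c = n ∧ (s, n) ∈ boundedWin G t₁ t₂ M) {s : S} {c : ℤ}
    (h : Reach G 0 (M + 1) T s c) : ∃ n : ℕ, c = n ∧ (s, n) ∈ boundedWin G t₁ t₂ M := by
  induction h with
  | base h => exact hT _ _ h
  | choose h0 h1 h2 he _ ih =>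
    obtain ⟨n, hn, hw⟩ := ih
    obtain ⟨c, rfl⟩ := Int.eq_ofNat_of_zero_le h1
    exact ⟨c, rfl, mem_boundedWin_of_forceStep (by omega)
      ⟨fun _ => ⟨_, _, n, he, hn, hw⟩, fun h => absurd h0 h⟩⟩
  | forced h0 h1 h2 _ ih =>
    obtain ⟨c, rfl⟩ := Int.eq_ofNat_of_zero_le h1
    exact ⟨c, rfl, mem_boundedWin_of_forceStep (by omega)
      ⟨fun h => absurd h h0, fun _ w s' he => ih w s' he⟩⟩

end BoundedWin

theorem exists_gap {ι : Type*} (V : Finset ι) (f : ι → ℕ) (b d : ℕ) :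
    ∃ k ≤ V.card, ∀ v ∈ V, b + k * d < f v → b + (k + 1) * d < f v := by
  by_contra! h
  have : Nonempty ι := let ⟨v, _⟩ := h 0 (Nat.zero_le _); ⟨v⟩
  choose! v hv h1 h2 using h
  have : (Finset.range (V.card + 1)).card ≤ V.card := by
    refine Finset.card_le_card_of_injOn v
      (fun k hk => hv k (by simpa [Nat.lt_succ_iff] using hk)) ?_
    have key : ∀ k l, k ≤ V.card → l ≤ V.card → k < l → v k ≠ v l := by
      intro k l hk hl hkl he
      have h3 := h2 k hk
      have h4 := h1 l hl
      rw [he] at h3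
      have := Nat.mul_le_mul_right d (Nat.succ_le_of_lt hkl)
      simp only [Nat.succ_eq_add_one] at this
      omega
    intro k hk l hl he
    simp only [Finset.coe_range, Set.mem_Iio, Nat.lt_succ_iff] at hk hl
    rcases lt_trichotomy k l with h | h | h
    · exact absurd he (key k l hk hl h)
    · exact h
    · exact absurd he.symm (key l k hl hk h)
  simp at this

/-- If finite credit suffices at all, then it suffices with exponentially bounded counters. -/
theorem mem_boundedWin_of_closedPotential {S : Type*} [Fintype S] {G : Game S} {t₁ t₂ : ℕ}
    (ht : 0 < t₂) {A : Set (S × ℕ)} {p : S × ℕ → ℕ} (hA : ClosedPotential G t₁ t₂ A p)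
    {γ : S × ℕ} (hγ : γ ∈ A) (hlow : t₂ * γ.2 ≤ t₁) :
    γ ∈ boundedWin G t₁ t₂ (t₁ * (Fintype.card S * (t₁ / t₂ + 1) + 2) / t₂ + G.W +
      2 ^ (Fintype.card S * G.W) * (Fintype.card S * G.W)) := by
  classical
  set N := Fintype.card S * (t₁ / t₂ + 1) with hN
  set c₀ := t₁ * (N + 2) / t₂ with hc₀
  set H := 2 ^ (Fintype.card S * G.W) * (Fintype.card S * G.W) with hH
  set M := c₀ + G.W + H with hM
  have le_c₀ : ∀ c, t₂ * c ≤ t₁ * (N + 2) → c ≤ c₀ := fun c h =>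
    (Nat.le_div_iff_mul_le ht).2 (by rwa [mul_comm])
  clear_value c₀
  clear hc₀
  by_contra hγw
  set V : Finset (S × ℕ) := (Finset.univ ×ˢ Finset.range (t₁ / t₂ + 1)).filter
    fun x => x ∈ A ∧ x ∉ boundedWin G t₁ t₂ M with hV
  have memV : ∀ x ∈ A, t₂ * x.2 ≤ t₁ → x ∉ boundedWin G t₁ t₂ M → x ∈ V := by
    intro x hx hl hw
    simp only [hV, Finset.mem_filter, Finset.mem_product, Finset.mem_univ, true_and,
      Finset.mem_range, Nat.lt_succ_iff]
    exact ⟨(Nat.le_div_iff_mul_le ht).2 (by rwa [mul_comm]), hx, hw⟩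
  have hVN : V.card ≤ N := (Finset.card_filter_le _ _).trans (by simp [hN])
  have hγV := memV γ hγ hlow hγw
  obtain ⟨v₀, hv₀, hmin⟩ := Finset.exists_min_image V p ⟨γ, hγV⟩
  set θ₀ := p v₀ with hθ₀
  obtain ⟨k, hk, hgap⟩ := exists_gap V p θ₀ t₁
  set θ := θ₀ + k * t₁ with hθ
  have hkN : k * t₁ ≤ t₁ * N := by
    rw [mul_comm]; exact Nat.mul_le_mul_left _ (hk.trans hVN)
  have lowWin : ∀ x ∈ A, t₂ * x.2 ≤ t₁ → p x < θ₀ → x ∈ boundedWin G t₁ t₂ M := by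
    intro x hx hl hp
    by_contra hw
    exact (hmin x (memV x hx hl hw)).not_gt hp
  set U : S → ℤ → Prop := fun s c => ∃ n : ℕ, c = n ∧ t₂ * n ≤ t₁ ∧
    (s, n) ∈ boundedWin G t₁ t₂ M with hU
  have escape : ∀ n s c, p (s, c) = n → (s, c) ∈ A → p (s, c) + t₁ < θ₀ →
      c ≤ c₀ + G.W + θ₀ →
      Reach G 0 (((c₀ + G.W : ℕ) : ℤ) + 1 + θ₀) U s c := by
    intro n
    induction n using Nat.strong_induction_on with
    | _ n ih =>
      intro s c hn hsc hp hc
      refine ForceStep.reach ((hA s c hsc).mono fun s' c' _ hq => ?_) (by omega)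
        (by push_cast; omega)
      rcases le_or_gt (t₂ * c') t₁ with hl | hl
      · exact .base ⟨c', rfl, hl, lowWin _ hq.1 hl (by omega)⟩
      · have := Nat.le_mul_of_pos_left c' ht
        exact ih (p (s', c')) (by omega) s' c' rfl hq.1 (by omega) (by omega)
  set C : Set (S × ℕ) := {x | x ∈ A ∧ p x ≤ θ ∧ t₂ * x.2 + p x ≤ θ + t₁ ∧ θ₀ ≤ p x + t₁} with hC
  have hCc : ∀ x ∈ C, x.2 ≤ c₀ := by
    rintro x ⟨-, h1, h2, h3⟩
    refine le_c₀ _ ?_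
    rw [mul_add]
    omega
  have hCW : C ⊆ boundedWin G t₁ t₂ M := by
    refine subset_boundedWin (p := p) (fun x hx => (hCc x hx).trans (by omega)) ?_
    intro s c hsc
    have hc := hCc _ hsc
    obtain ⟨hscA, h1, h2, h3⟩ := hsc
    refine (hA s c hscA).mono fun s' c' hc' hq => ?_
    by_cases hw : (s', c') ∈ boundedWin G t₁ t₂ M
    · exact Or.inl hw
    rcases le_or_gt (t₂ * c') t₁ with hl | hl
    · have hmem := memV _ hq.1 hl hw
      have h4 := hmin _ hmem
      have h5 := hgap _ hmem
      rw [add_mul, one_mul] at h5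
      have h6 : p (s', c') ≤ θ := by
        by_contra! h
        have := h5 h
        omega
      exact Or.inr ⟨⟨hq.1, h6, by simp only; omega, by omega⟩, hq.2⟩
    · rcases le_or_gt θ₀ (p (s', c') + t₁) with h4 | h4
      · exact Or.inr ⟨⟨hq.1, by omega, by simp only; omega, h4⟩, hq.2⟩
      · simp only at hc
        have h5 := escape _ s' c' rfl hq.1 h4 (by omega)
        have h6 := (heightStable G (n := H) θ₀ le_rfl).reach_of_reach (by positivity)
          (by positivity) (T := U) (l := (c₀ + G.W : ℕ))
          (by
            rintro s c ⟨n, rfl, hn, -⟩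
            have := le_c₀ n (hn.trans (Nat.le_mul_of_pos_right _ (by omega)))
            push_cast
            omega)
          h5 (by push_cast; omega)
        obtain ⟨n, hn, hnw⟩ := mem_boundedWin_of_reach (M := M) (t₁ := t₁) (t₂ := t₂)
          (fun s c ⟨n, h7, _, h8⟩ => ⟨n, h7, h8⟩)
          (Reach.mono_hi (by rw [hM]; push_cast; linarith) h6)
        obtain rfl : c' = n := by exact_mod_cast hn
        exact Or.inl hnw
  have hv₀' := hv₀
  simp only [hV, Finset.mem_filter, Finset.mem_product, Finset.mem_univ, true_and,
      Finset.mem_range, Nat.lt_succ_iff, Nat.le_div_iff_mul_le ht] at hv₀'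
  obtain ⟨h1, h2, h3⟩ := hv₀'
  refine h3 (hCW ⟨h2, by omega, ?_, by omega⟩)
  rw [mul_comm] at h1
  omega

section Expanded

variable {S : Type*} {G : Game S} {t : ℚ} {t₁ t₂ : ℕ}

theorem finite_ExpE_src [Finite S] (G : Game S) (t : ℚ) (γ : Conf S) :
    {e ∈ ExpE G t | e.1 = γ}.Finite := by
  obtain ⟨b, hb⟩ : ∃ b : ℕ, ∀ s c, γ = some (s, c) → c + G.W ≤ b := by
    rcases γ with _ | ⟨s, c⟩
    · exact ⟨0, by simp⟩
    · refine ⟨c + G.W, fun s' c' h => ?_⟩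
      obtain ⟨-, rfl⟩ := Prod.mk.inj (Option.some.inj h)
      exact le_rfl
  refine (((Set.finite_univ (α := S)).prod (Set.finite_Iic b)).image
    (fun x : S × ℕ => ((γ, (x.2 : ℤ), some x) : WEdge (Conf S)))).union
    (Set.finite_singleton ((γ, ⌈t⌉ + 1, none) : WEdge (Conf S))) |>.subset ?_
  rintro e ⟨⟨s, c, w, s', c', he, hc, rfl⟩ | ⟨s, c, w, s', he, hc, rfl⟩ | rfl, rfl⟩
  · refine Or.inl ⟨(s', c'), ⟨Set.mem_univ _, ?_⟩, rfl⟩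
    have h1 := (G.wbound _ he).2
    have h2 := hb s c rfl
    simp only [Set.mem_Iic] at h1 ⊢
    omega
  · exact Or.inr rfl
  · exact Or.inr rfl

theorem sum_credit (π : ℕ → WEdge (Conf S)) (n : ℕ) :
    ∑ i ∈ Finset.range n, ((t₁ : ℤ) - t₂ * (π i).2.1) = n * t₁ - t₂ * EL π n := by
  simp [EL, Finset.sum_sub_distrib, Finset.mul_sum]

theorem credit_ge_of_limsupLE (ht : 1 ≤ t₂) (hdiv : t = (t₁ : ℚ) / (t₂ : ℚ))
    {π : ℕ → WEdge (Conf S)} (h : LimsupLE (MP π) t) {D : ℕ} (hD : 0 < D) :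
    ∃ N : ℕ, ∀ n ≥ N, -(n : ℤ) ≤
      D * ∑ i ∈ Finset.range n, ((t₁ : ℤ) - t₂ * (π i).2.1) := by
  have ht' : (0 : ℚ) < t₂ := by exact_mod_cast ht
  have hD' : (0 : ℚ) < D := by exact_mod_cast hD
  obtain ⟨N, hN⟩ := h (1 / (D * t₂)) (by positivity)
  refine ⟨max N 1, fun n hn => ?_⟩
  have h1 := hN n (le_of_max_le_left hn)
  have hn' : (0 : ℚ) < n := by exact_mod_cast (le_of_max_le_right hn)
  rw [MP, div_le_iff₀ hn', hdiv] at h1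
  have h2 : (D * t₂ : ℚ) * (EL π n : ℚ) ≤ D * t₁ * n + n := by
    calc (D * t₂ : ℚ) * (EL π n : ℚ)
        ≤ (D * t₂) * (((t₁ : ℚ) / t₂ + 1 / (D * t₂)) * n) :=
          mul_le_mul_of_nonneg_left h1 (by positivity)
      _ = D * t₁ * n + n := by field_simp
  have h3 : (D * t₂ : ℤ) * EL π n ≤ D * t₁ * n + n := by exact_mod_cast h2
  rw [sum_credit]
  linarith

theorem exists_closedPotential_of_strategy [Finite S] {sinit : S} (ht : 1 ≤ t₂)
    (hdiv : t = (t₁ : ℚ) / (t₂ : ℚ)) {σ : List (WEdge (Conf S)) → WEdge (Conf S)}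
    (hσ : IsStrategy (ExpE G t) (ExpS0 G) (some (sinit, 0)) σ)
    (hwin : ∀ π, IsOutcome (ExpE G t) (ExpS0 G) (some (sinit, 0)) σ π → LimsupLE (MP π) t) :
    ∃ A p, ClosedPotential G t₁ t₂ A p ∧ (sinit, 0) ∈ A := by
  have ht' : (0 : ℚ) < t₂ := by exact_mod_cast ht
  have hceil : (t₁ : ℤ) ≤ t₂ * ⌈t⌉ := by
    have h1 : (t₁ : ℚ) = t₂ * t := by rw [hdiv]; field_simp
    have h2 : (t₁ : ℚ) ≤ t₂ * (⌈t⌉ : ℚ) := by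
      rw [h1]; exact mul_le_mul_of_nonneg_left (Int.le_ceil t) ht'.le
    exact_mod_cast h2
  have ht2 : (1 : ℤ) ≤ t₂ := by exact_mod_cast ht
  set Low : Set (Conf S) := {γ | ∃ s c, γ = some (s, c) ∧ t₂ * c ≤ t₁} with hLow
  obtain ⟨A, p, hs, hA⟩ := exists_potential (g := fun e => (t₁ : ℤ) - t₂ * e.2.1) (Low := Low)
    (finite_ExpE_src G t)
    (by
      refine (((Set.finite_univ (α := S)).prod (Set.finite_Iic t₁)).image some).subset ?_
      rintro γ ⟨s, c, rfl, h⟩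
      exact ⟨(s, c), ⟨Set.mem_univ _, (Nat.le_mul_of_pos_left c ht).trans h⟩, rfl⟩)
    t₁
    (by
      rintro e (⟨s, c, w, s', c', he, hc, rfl⟩ | ⟨s, c, w, s', he, hc, rfl⟩ | rfl)
      · have : (0 : ℤ) ≤ t₂ * c' := by positivity
        simp only
        linarith
      all_goals
        simp only
        linarith [(Int.natCast_nonneg t₁)])
    (by
      rintro e (⟨s, c, w, s', c', he, hc, rfl⟩ | ⟨s, c, w, s', he, hc, rfl⟩ | rfl) hl
      · have h1 : ¬ t₂ * c' ≤ t₁ := fun h => hl ⟨s', c', rfl, h⟩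
        simp only
        have h2 : (t₁ : ℤ) + 1 ≤ t₂ * c' := by exact_mod_cast not_le.1 h1
        linarith
      all_goals
        simp only
        linarith)
    hσ (fun π hπ D hD => credit_ge_of_limsupLE ht hdiv (hwin π hπ) hD)
  have hnone : none ∉ A := by
    intro h
    have := ((hA _ h).2 (by rintro ⟨s, c, -, h⟩; cases h) _ (Or.inr (Or.inr rfl)) rfl).2
    simp only at this
    linarith
  refine ⟨{x | some x ∈ A}, fun x => p (some x), ?_, hs⟩
  intro s c hsc
  refine ⟨fun h0 => ?_, fun h0 w s' he => ?_⟩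
  · obtain ⟨e, he, hsrc, hmem, hp⟩ := (hA _ hsc).1 ⟨s, c, h0, rfl⟩
    rcases he with ⟨s₀, c₀, w, s', c', he, hc, rfl⟩ | ⟨s₀, c₀, w, s', he, hc, rfl⟩ | rfl
    · obtain ⟨rfl, rfl⟩ := Prod.mk.inj (Option.some.inj hsrc)
      refine ⟨w, s', c', he, hc, hmem, ?_⟩
      simp only at hp
      zify
      linarith
    all_goals exact absurd hmem hnone
  · have hout := (hA _ hsc).2 (by
      rintro ⟨s₀, c₀, h, hsc⟩
      obtain ⟨rfl, rfl⟩ := Prod.mk.inj (Option.some.inj hsc)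
      exact h0 h)
    rcases lt_or_ge ((c : ℤ) + w) 0 with h | h
    · exact absurd (hout _ (Or.inr (Or.inl ⟨s, c, w, s', he, h, rfl⟩)) rfl).1 hnone
    · obtain ⟨c', hc'⟩ := Int.eq_ofNat_of_zero_le h
      obtain ⟨hmem, hp⟩ := hout _ (Or.inl ⟨s, c, w, s', c', he, hc', rfl⟩) rfl
      refine ⟨c', hc', hmem, ?_⟩
      simp only at hp
      zify
      linarith

theorem exists_edge (G : Game S) (t : ℚ) (s : S) (c : ℕ) :
    ∃ e ∈ ExpE G t, e.1 = some (s, c) := by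
  obtain ⟨w, s', he⟩ := G.total s
  rcases lt_or_ge ((c : ℤ) + w) 0 with h | h
  · exact ⟨_, Or.inr (Or.inl ⟨s, c, w, s', he, h, rfl⟩), rfl⟩
  · obtain ⟨c', hc'⟩ := Int.eq_ofNat_of_zero_le h
    exact ⟨_, Or.inl ⟨s, c, w, s', c', he, hc', rfl⟩, rfl⟩

theorem limsupLE_of_EL_le (ht : 1 ≤ t₂) (hdiv : t = (t₁ : ℚ) / (t₂ : ℚ))
    {π : ℕ → WEdge (Conf S)} {K : ℕ} (h : ∀ n, (t₂ : ℤ) * EL π n ≤ K + n * t₁) :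
    LimsupLE (MP π) t := by
  intro ε hε
  have ht' : (1 : ℚ) ≤ t₂ := by exact_mod_cast ht
  obtain ⟨N, hN⟩ := exists_nat_ge ((K : ℚ) / ε)
  refine ⟨max N 1, fun n hn => ?_⟩
  have hn' : (0 : ℚ) < n := by exact_mod_cast (le_of_max_le_right hn)
  have hKn : (K : ℚ) ≤ n * ε := by
    rw [← div_le_iff₀ hε]
    exact hN.trans (by exact_mod_cast le_of_max_le_left hn)
  have h1 : (t₂ : ℚ) * EL π n ≤ K + n * t₁ := by exact_mod_cast h n
  rw [MP, div_le_iff₀ hn']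
  have h2 : (t₂ : ℚ) * ((t + ε) * n) = n * t₁ + t₂ * (n * ε) := by
    rw [hdiv]; field_simp
  refine le_of_mul_le_mul_left ?_ (by linarith : (0 : ℚ) < t₂)
  rw [h2]
  have : n * ε ≤ t₂ * (n * ε) := le_mul_of_one_le_left (by positivity) ht'
  linarith

theorem exists_strategy_of_closedPotential {sinit : S} (ht : 1 ≤ t₂)
    (hdiv : t = (t₁ : ℚ) / (t₂ : ℚ)) {A : Set (S × ℕ)} {p : S × ℕ → ℕ}
    (hA : ClosedPotential G t₁ t₂ A p) (hs : (sinit, 0) ∈ A) :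
    ∃ σ, IsStrategy (ExpE G t) (ExpS0 G) (some (sinit, 0)) σ ∧
      ∀ π, IsOutcome (ExpE G t) (ExpS0 G) (some (sinit, 0)) σ π →
        LimsupLE (MP π) t ∧
        ∀ n (s : S) (c : ℕ), StAt (some (sinit, 0)) π n = some (s, c) → (s, c) ∈ A := by
  have hf : ∀ γ : Conf S, ∃ e : WEdge (Conf S), γ ∈ ExpS0 G → e ∈ ExpE G t ∧ e.1 = γ ∧
      ∀ s c, γ = some (s, c) → (s, c) ∈ A → ∃ (s' : S) (c' : ℕ), e.2 = ((c' : ℤ), some (s', c')) ∧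
        (s', c') ∈ A ∧ p (s', c') + t₂ * c' ≤ p (s, c) + t₁ := by
    intro γ
    by_cases hγ : γ ∈ ExpS0 G
    · obtain ⟨s, c, h0, rfl⟩ := hγ
      by_cases hsc : (s, c) ∈ A
      · obtain ⟨w, s', c', he, hc, hq⟩ := (hA s c hsc).1 h0
        refine ⟨(some (s, c), (c' : ℤ), some (s', c')), fun _ =>
          ⟨Or.inl ⟨s, c, w, s', c', he, hc, rfl⟩, rfl, fun s₀ c₀ h _ => ?_⟩⟩
        obtain ⟨rfl, rfl⟩ := Prod.mk.inj (Option.some.inj h)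
        exact ⟨s', c', rfl, hq⟩
      · obtain ⟨e, he, hsrc⟩ := exists_edge G t s c
        refine ⟨e, fun _ => ⟨he, hsrc, fun s₀ c₀ h h' => ?_⟩⟩
        obtain ⟨rfl, rfl⟩ := Prod.mk.inj (Option.some.inj h)
        exact absurd h' hsc
    · exact ⟨(none, 0, none), fun h => absurd h hγ⟩
  choose f hf using hf
  refine ⟨fun ρ => f (EndSt (some (sinit, 0)) ρ),
    fun ρ _ h0 => ⟨(hf _ h0).1, (hf _ h0).2.1⟩, fun π hπ => ?_⟩
  have inv : ∀ n, ∃ s c, StAt (some (sinit, 0)) π n = some (s, c) ∧ (s, c) ∈ A ∧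
      (p (s, c) : ℤ) + t₂ * EL π n ≤ p (sinit, 0) + n * t₁ := by
    intro n
    induction n with
    | zero => exact ⟨sinit, 0, rfl, hs, by simp [EL]⟩
    | succ n ih =>
      obtain ⟨s, c, hst, hsc, hp⟩ := ih
      have key : ∃ (s' : S) (c' : ℕ), (π n).2 = ((c' : ℤ), some (s', c')) ∧
          (s', c') ∈ A ∧ p (s', c') + t₂ * c' ≤ p (s, c) + t₁ := by
        by_cases h0 : s ∈ G.S0
        · have hmem : EndSt (some (sinit, 0)) (Pref π n) ∈ ExpS0 G := by
            rw [EndSt_Pref, hst]; exact ⟨s, c, h0, rfl⟩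
          rw [hπ.2 n hmem]
          exact (hf _ hmem).2.2 s c (by rw [EndSt_Pref, hst]) hsc
        · have hsrc := hπ.1.src n
          rw [hst] at hsrc
          have hforce := (hA s c hsc).2 h0
          rcases hπ.1.1 n with ⟨s₀, c₀, w, s', c', he, hc, hn⟩ | ⟨s₀, c₀, w, s', he, hc, hn⟩ | hn
          all_goals rw [hn] at hsrc ⊢
          · obtain ⟨rfl, rfl⟩ := Prod.mk.inj (Option.some.inj hsrc)
            obtain ⟨c'', hc'', hq⟩ := hforce w s' he
            obtain rfl : c' = c'' := by omega
            exact ⟨s', c', rfl, hq⟩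
          · obtain ⟨rfl, rfl⟩ := Prod.mk.inj (Option.some.inj hsrc)
            obtain ⟨c'', hc'', -⟩ := hforce w s' he
            omega
          · cases hsrc
      obtain ⟨s', c', hn, hmem, hle⟩ := key
      refine ⟨s', c', by rw [StAt, hn], hmem, ?_⟩
      rw [EL, Finset.sum_range_succ, ← EL, hn]
      zify at hle
      push_cast
      linarith
  refine ⟨limsupLE_of_EL_le ht hdiv (K := p (sinit, 0)) fun n => ?_, fun n s c h => ?_⟩
  · obtain ⟨s, c, -, -, h⟩ := inv n
    have := Int.natCast_nonneg (p (s, c))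
    linarith
  · obtain ⟨s', c', h', hmem, -⟩ := inv n
    rw [h] at h'
    rwa [Option.some.inj h']

end Expanded

theorem Game.card_le_ncard_E {S : Type*} [Fintype S] (G : Game S) :
    Fintype.card S ≤ G.E.ncard := by
  have hfin : G.E.Finite := by
    refine ((Set.finite_univ (α := S)).prod
      ((Set.finite_Icc (-(G.W : ℤ)) G.W).prod (Set.finite_univ (α := S)))).subset fun e he => ?_
    exact ⟨Set.mem_univ _, G.wbound e he, Set.mem_univ _⟩
  choose w s' h using G.total
  rw [← Nat.card_eq_fintype_card, ← Set.ncard_univ]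
  exact Set.ncard_le_ncard_of_injOn (fun s => (s, w s, s' s)) (fun s _ => h s)
    (fun _ _ _ _ h => (Prod.mk.inj h).1) hfin

theorem counter_bound_le (t₁ t₂ n W e : ℕ) (ht : 1 ≤ t₂) (hn : 1 ≤ n) (he : n ≤ e) :
    t₁ * (n * (t₁ / t₂ + 1) + 2) / t₂ + W + 2 ^ (n * W) * (n * W) ≤
      2 ^ (6 * (W + n + e * W + n * (t₁ / t₂ + 1))) := by
  set a := t₁ / t₂ + 1 with ha
  set Y := W + n + e * W + n * a with hY
  have hna : a ≤ n * a := Nat.le_mul_of_pos_left a hn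
  have hnW : n * W ≤ e * W := Nat.mul_le_mul_right W he
  have h1 : t₁ * (n * a + 2) / t₂ ≤ 2 ^ (4 * Y) := by
    have h2 : t₁ ≤ t₂ * a := (Nat.lt_mul_div_succ t₁ ht).le
    calc t₁ * (n * a + 2) / t₂ ≤ t₂ * (a * (n * a + 2)) / t₂ := by
          rw [← mul_assoc]; exact Nat.div_le_div_right (Nat.mul_le_mul_right _ h2)
      _ = a * (n * a + 2) := Nat.mul_div_cancel_left _ ht
      _ ≤ 2 ^ (n * a) * 2 ^ (n * a + 2) :=
          Nat.mul_le_mul (hna.trans Nat.lt_two_pow_self.le) Nat.lt_two_pow_self.le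
      _ = 2 ^ (n * a + (n * a + 2)) := (pow_add _ _ _).symm
      _ ≤ 2 ^ (4 * Y) := Nat.pow_le_pow_right (by norm_num) (by omega)
  have h2 : W ≤ 2 ^ (4 * Y) :=
    Nat.lt_two_pow_self.le.trans (Nat.pow_le_pow_right (by norm_num) (by omega))
  have h3 : 2 ^ (n * W) * (n * W) ≤ 2 ^ (4 * Y) := by
    calc 2 ^ (n * W) * (n * W) ≤ 2 ^ (n * W) * 2 ^ (n * W) :=
          Nat.mul_le_mul_left _ Nat.lt_two_pow_self.le
      _ = 2 ^ (n * W + n * W) := (pow_add _ _ _).symm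
      _ ≤ 2 ^ (4 * Y) := Nat.pow_le_pow_right (by norm_num) (by omega)
  calc _ ≤ 2 ^ (4 * Y) * 2 ^ 2 := by omega
    _ = 2 ^ (4 * Y + 2) := (pow_add _ _ _).symm
    _ ≤ 2 ^ (6 * Y) := Nat.pow_le_pow_right (by norm_num) (by omega)

/-- There is an absolute constant `k` such that: for every finite
weighted game `G` with maximal absolute weight `W` and threshold `t = t₁/t₂`, if `P₀`
has a winning strategy from `(s_init, 0)` in the expanded game `G'` for the mean-payoff
objective `MP(t)`, then `P₀` has a winning strategy `σ'` from `(s_init, 0)` for `MP(t)`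
all of whose outcomes only visit configurations `(s, c)` with `c ≤ M'`, where
`M' = 2^{k·(t + W·(8 t₁ t₂ (t+1)³ |S|² + 1) + |S| + |E|·W + |S|·(⌈t⌉+1))}`. -/
theorem statement10 :
    ∃ k : ℕ, ∀ (S : Type) [Fintype S], ∀ (G : Game S) (sinit : S)
      (t₁ t₂ : ℕ), 1 ≤ t₂ → ∀ t : ℚ, t = (t₁ : ℚ) / (t₂ : ℚ) →
      (∃ σ, IsStrategy (ExpE G t) (ExpS0 G) (some (sinit, 0)) σ ∧
        ∀ π, IsOutcome (ExpE G t) (ExpS0 G) (some (sinit, 0)) σ π →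
          LimsupLE (MP π) t) →
      ∃ σ', IsStrategy (ExpE G t) (ExpS0 G) (some (sinit, 0)) σ' ∧
        ∀ π, IsOutcome (ExpE G t) (ExpS0 G) (some (sinit, 0)) σ' π →
          LimsupLE (MP π) t ∧
          ∀ n (s : S) (c : ℕ), StAt (some (sinit, 0)) π n = some (s, c) →
            (c : ℝ) ≤ (2 : ℝ) ^ ((k : ℝ) * ((t : ℝ) +
              (G.W : ℝ) * (8 * (t₁ : ℝ) * (t₂ : ℝ) * ((t : ℝ) + 1) ^ 3 *
                (Fintype.card S : ℝ) ^ 2 + 1) +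
              (Fintype.card S : ℝ) + (G.E.ncard : ℝ) * (G.W : ℝ) +
              (Fintype.card S : ℝ) * ((⌈t⌉ : ℝ) + 1))) := by
  refine ⟨6, ?_⟩
  rintro S _ G sinit t₁ t₂ ht t hdiv ⟨σ, hσ, hwin⟩
  obtain ⟨A, p, hA, hs⟩ := exists_closedPotential_of_strategy ht hdiv hσ hwin
  have hmem := mem_boundedWin_of_closedPotential ht hA hs (by simp)
  obtain ⟨σ', hσ', hout⟩ := exists_strategy_of_closedPotential ht hdiv
    closedPotential_boundedWin hmem
  refine ⟨σ', hσ', fun π hπ => ⟨(hout π hπ).1, fun n s c hc => ?_⟩⟩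
  have h1 : c ≤ _ := (le_of_mem_boundedWin ((hout π hπ).2 n s c hc)).trans
    (counter_bound_le t₁ t₂ (Fintype.card S) G.W G.E.ncard ht
      (Fintype.card_pos_iff.2 ⟨sinit⟩) G.card_le_ncard_E)
  have h2 : (c : ℝ) ≤ (2 : ℝ) ^ (6 * (G.W + Fintype.card S + G.E.ncard * G.W +
      Fintype.card S * (t₁ / t₂ + 1))) := by exact_mod_cast h1
  refine h2.trans ?_
  rw [← Real.rpow_natCast]
  refine Real.rpow_le_rpow_of_exponent_le (by norm_num) ?_
  have ht0 : 0 ≤ t := by rw [hdiv]; positivity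
  have ht0' : (0 : ℝ) ≤ (t : ℝ) := by exact_mod_cast ht0
  have hq : ((t₁ / t₂ : ℕ) : ℝ) ≤ (⌈t⌉ : ℝ) := by
    have h3 : ((t₁ / t₂ : ℕ) : ℚ) ≤ (⌈t⌉ : ℚ) :=
      Nat.cast_div_le.trans (hdiv ▸ Int.le_ceil t)
    have h3' : ((t₁ / t₂ : ℕ) : ℤ) ≤ ⌈t⌉ := by
      rw [← Int.cast_le (R := ℚ), Int.cast_natCast]; exact h3
    have h3'' := (Int.cast_le (R := ℝ)).2 h3'
    rwa [Int.cast_natCast] at h3''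
  have h4 : (0 : ℝ) ≤ (G.W : ℝ) * (8 * (t₁ : ℝ) * (t₂ : ℝ) * ((t : ℝ) + 1) ^ 3 *
      (Fintype.card S : ℝ) ^ 2) := by positivity
  have h5 := mul_le_mul_of_nonneg_left hq (Nat.cast_nonneg (α := ℝ) (Fintype.card S))
  push_cast
  linarith

end AvgEnergy
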